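/- Let N ≥ 2, let H be a Finsler norm on ℝ^N, and let B satisfy assumption (h_B) with p ≥ 2 and parameters κ ∈ [0,1], γ > 0, Γ > 0. Let q > 1 and let u be a stable weak solution of −div(B'(H(∇u))∇H(∇u)) = |u|^{q−1}u in ℝ^N. Suppose Γκ^{p−2}(p−1) ≥ 1, q > Γ²κ^{p−2}γ^{−1}(p−1)², and N < g(q) := 2[Γ²κ^{p−2}γ^{−1}(p−1)²(q−1) + 2q + 2√(q(q − Γ²κ^{p−2}γ^{−1}(p−1)²))] / [Γ²κ^{p−2}γ^{−1}(p−1)²(q−1)]. Then u ≡ 0. -/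

import Mathlib

open MeasureTheory Real Set
open scoped RealInnerProductSpace

noncomputable section

/-- A Finsler norm on `ℝ^N`: a norm of class `C²` away from the origin whose
open unit ball is uniformly convex. -/
def IsFinslerNorm {N : ℕ} (H : EuclideanSpace ℝ (Fin N) → ℝ) : Prop :=
  (∀ x, H x = 0 ↔ x = 0) ∧
  (∀ (c : ℝ) (x : EuclideanSpace ℝ (Fin N)), H (c • x) = |c| * H x) ∧
  (∀ x y, H (x + y) ≤ H x + H y) ∧
  ContDiffOn ℝ 2 H {(0 : EuclideanSpace ℝ (Fin N))}ᶜ ∧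
  ∃ Λ : ℝ, 0 < Λ ∧ ∀ ξ : EuclideanSpace ℝ (Fin N), H ξ = 1 →
    ∀ v : EuclideanSpace ℝ (Fin N), ⟪gradient H ξ, v⟫ = 0 →
      Λ * ‖v‖ ^ 2 ≤ ⟪fderiv ℝ (gradient H) ξ v, v⟫

/-- Assumption `(h_B)` with parameters `p, κ, γ, Γ`. -/
def SatisfiesHB (B : ℝ → ℝ) (p κ γ Γ : ℝ) : Prop :=
  ContDiffOn ℝ 2 B (Set.Ioi 0) ∧ B 0 = 0 ∧ deriv B 0 = 0 ∧
  (∀ t : ℝ, 0 < t → 0 < B t ∧ 0 < deriv B t ∧ 0 < deriv (deriv B) t) ∧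
  1 < p ∧ 0 ≤ κ ∧ κ ≤ 1 ∧ 0 < γ ∧ 0 < Γ ∧
  (∀ t : ℝ, 0 < t →
    γ * (κ + t) ^ (p - 2) * t ≤ deriv B t ∧ deriv B t ≤ Γ * (κ + t) ^ (p - 2) * t) ∧
  (∀ t : ℝ, 0 < t →
    γ * (p - 1) * (κ + t) ^ (p - 2) ≤ deriv (deriv B) t ∧
      deriv (deriv B) t ≤ Γ * (p - 1) * (κ + t) ^ (p - 2))

/-- `u` is a weak solution of `-div(B'(H(∇u)) ∇H(∇u)) = |u|^{q-1} u` in `Ω`. -/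
def IsWeakSolutionOn {N : ℕ} (Ω : Set (EuclideanSpace ℝ (Fin N))) (B : ℝ → ℝ)
    (H : EuclideanSpace ℝ (Fin N) → ℝ) (u : EuclideanSpace ℝ (Fin N) → ℝ) (q : ℝ) : Prop :=
  ∀ φ : EuclideanSpace ℝ (Fin N) → ℝ, ContDiff ℝ 1 φ → HasCompactSupport φ → tsupport φ ⊆ Ω →
    ∫ x in Ω, deriv B (H (gradient u x)) * ⟪gradient H (gradient u x), gradient φ x⟫
      = ∫ x in Ω, |u x| ^ (q - 1) * u x * φ x

/-- Stability of the linearized operator of `u`, tested against `C¹` functions compactly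
supported in `S ⊆ Ω` (take `S = Ω` for stability, `S = Ω \ K` for stability outside a
compact set `K`). -/
def IsStableOn {N : ℕ} (Ω S : Set (EuclideanSpace ℝ (Fin N))) (B : ℝ → ℝ)
    (H : EuclideanSpace ℝ (Fin N) → ℝ) (u : EuclideanSpace ℝ (Fin N) → ℝ) (q : ℝ) : Prop :=
  ∀ φ : EuclideanSpace ℝ (Fin N) → ℝ, ContDiff ℝ 1 φ → HasCompactSupport φ → tsupport φ ⊆ S →
    0 ≤ (∫ x in Ω, deriv (deriv B) (H (gradient u x)) *
            ⟪gradient H (gradient u x), gradient φ x⟫ ^ 2)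
        + (∫ x in Ω, deriv B (H (gradient u x)) *
            ⟪fderiv ℝ (gradient H) (gradient u x) (gradient φ x), gradient φ x⟫)
        - ∫ x in Ω, q * |u x| ^ (q - 1) * φ x ^ 2

lemma hasDerivAt_abs_rpow_mul_self {a : ℝ} (ha : 0 < a) (s : ℝ) :
    HasDerivAt (fun s : ℝ => |s| ^ a * s) ((a + 1) * |s| ^ a) s := by
  rcases eq_or_ne s 0 with rfl | hs
  · rw [hasDerivAt_iff_tendsto_slope]
    have h : Filter.Tendsto (fun t : ℝ => |t| ^ a) (nhdsWithin 0 {0}ᶜ) (nhds (|(0 : ℝ)| ^ a)) :=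
      ((continuous_abs.rpow_const fun _ => Or.inr ha.le).tendsto 0).mono_left nhdsWithin_le_nhds
    have h0 : (a + 1) * |(0 : ℝ)| ^ a = |(0 : ℝ)| ^ a := by
      simp [Real.zero_rpow ha.ne']
    rw [h0]
    refine h.congr' ?_
    filter_upwards [self_mem_nhdsWithin] with t ht
    have ht' : t ≠ 0 := ht
    simp [slope_def_field, ht']
  · have h1 := ((hasDerivAt_abs hs).rpow_const (p := a) (Or.inl (abs_ne_zero.2 hs))).mul
      (hasDerivAt_id s)
    refine h1.congr_deriv ?_
    have hsg : ((SignType.sign s : SignType) : ℝ) * s = |s| := sign_mul_self s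
    have h3 : |s| ^ (a - 1) * |s| = |s| ^ a := by
      rw [Real.rpow_sub_one (abs_ne_zero.2 hs)]
      field_simp [abs_ne_zero.2 hs]
    simp only [id, mul_one]
    rw [← h3, ← hsg]
    ring

lemma contDiff_abs_rpow_mul_self {a : ℝ} (ha : 0 < a) :
    ContDiff ℝ 1 (fun s : ℝ => |s| ^ a * s) := by
  rw [contDiff_one_iff_deriv]
  refine ⟨fun s => (hasDerivAt_abs_rpow_mul_self ha s).differentiableAt, ?_⟩
  rw [funext fun s => (hasDerivAt_abs_rpow_mul_self ha s).deriv]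
  exact continuous_const.mul (continuous_abs.rpow_const fun _ => Or.inr ha.le)

namespace IsFinslerNorm

variable {N : ℕ} {H : EuclideanSpace ℝ (Fin N) → ℝ}

lemma map_zero (hH : IsFinslerNorm H) : H 0 = 0 := (hH.1 0).2 rfl

lemma nonneg (hH : IsFinslerNorm H) (x : EuclideanSpace ℝ (Fin N)) : 0 ≤ H x := by
  have h1 := hH.2.2.1 x ((-1 : ℝ) • x)
  rw [hH.2.1] at h1
  simp [hH.map_zero] at h1
  linarith

lemma map_smul_of_pos (hH : IsFinslerNorm H) {c : ℝ} (hc : 0 < c)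
    (x : EuclideanSpace ℝ (Fin N)) : H (c • x) = c * H x := by
  rw [hH.2.1, abs_of_pos hc]

lemma contDiffAt (hH : IsFinslerNorm H) {x : EuclideanSpace ℝ (Fin N)} (hx : x ≠ 0) :
    ContDiffAt ℝ 2 H x :=
  hH.2.2.2.1.contDiffAt (isOpen_compl_singleton.mem_nhds hx)

lemma exists_le_norm (hH : IsFinslerNorm H) : ∃ L : ℝ, 0 ≤ L ∧ ∀ x, H x ≤ L * ‖x‖ := by
  obtain ⟨L, hL⟩ := (isCompact_sphere (0 : EuclideanSpace ℝ (Fin N)) 1).exists_bound_of_continuousOn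
    (f := H) fun x hx => (hH.contDiffAt (by
      rintro rfl; simp at hx)).continuousAt.continuousWithinAt
  refine ⟨max L 0, le_max_right _ _, fun x => ?_⟩
  rcases eq_or_ne x 0 with rfl | hx
  · simp [hH.map_zero]
  · have hx' : 0 < ‖x‖ := norm_pos_iff.2 hx
    have h1 := hL (‖x‖⁻¹ • x) (by simp [norm_smul, hx'.ne'])
    have h2 := (le_abs_self _).trans h1
    rw [hH.map_smul_of_pos (inv_pos.2 hx'), inv_mul_le_iff₀ hx', mul_comm] at h2
    exact h2.trans (by gcongr; exact le_max_left _ _)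

lemma exists_lipschitz (hH : IsFinslerNorm H) : ∃ L : NNReal, LipschitzWith L H := by
  obtain ⟨L, hL0, hL⟩ := hH.exists_le_norm
  refine ⟨⟨L, hL0⟩, LipschitzWith.of_le_add_mul _ fun x y => ?_⟩
  have h1 := hH.2.2.1 y (x - y)
  have h2 := hL (x - y)
  rw [add_sub_cancel] at h1
  rw [dist_eq_norm]
  exact h1.trans (by gcongr; exact h2)

lemma continuous (hH : IsFinslerNorm H) : Continuous H :=
  hH.exists_lipschitz.choose_spec.continuous

lemma exists_gradient_bound (hH : IsFinslerNorm H) :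
    ∃ L : ℝ, 0 ≤ L ∧ ∀ ξ v, |⟪gradient H ξ, v⟫| ≤ L * ‖v‖ := by
  obtain ⟨L, hL⟩ := hH.exists_lipschitz
  refine ⟨L, L.2, fun ξ v => (abs_real_inner_le_norm _ _).trans ?_⟩
  gcongr
  rw [gradient, LinearIsometryEquiv.norm_map]
  exact norm_fderiv_le_of_lipschitz ℝ hL

lemma gradient_zero (hH : IsFinslerNorm H) : gradient H 0 = 0 := by
  have h1 : (fun x => H ((-1 : ℝ) • x)) = H := by
    funext x; rw [hH.2.1]; simp
  have h2 := fderiv_comp_smul (𝕜 := ℝ) (f := H) (x := 0) (c := (-1 : ℝ))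
  rw [h1, smul_zero] at h2
  have h3 : fderiv ℝ H 0 = 0 := by
    have : (2 : ℝ) • fderiv ℝ H 0 = 0 := by
      rw [two_smul]; nth_rewrite 1 [h2]; simp
    simpa using this
  rw [gradient, h3, LinearIsometryEquiv.map_zero]

lemma gradient_smul (hH : IsFinslerNorm H) {c : ℝ} (hc : 0 < c)
    (x : EuclideanSpace ℝ (Fin N)) : gradient H (c • x) = gradient H x := by
  have h2 := fderiv_comp_smul (𝕜 := ℝ) (f := H) (x := x) (c := c)
  have h1 : (fun x => H (c • x)) = c • H := by
    funext x; rw [hH.map_smul_of_pos hc]; simp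
  rw [h1, fderiv_const_smul_field] at h2
  have h3 := smul_right_injective _ hc.ne' h2
  simp only [gradient]
  rw [← h3]

lemma inner_gradient_self (hH : IsFinslerNorm H) (ξ : EuclideanSpace ℝ (Fin N)) :
    ⟪gradient H ξ, ξ⟫ = H ξ := by
  rcases eq_or_ne ξ 0 with rfl | hξ
  · simp [hH.map_zero]
  · have hd : HasFDerivAt H (fderiv ℝ H ξ) ((1 : ℝ) • ξ) := by
      rw [one_smul]
      exact ((hH.contDiffAt hξ).differentiableAt (by norm_num)).hasFDerivAt
    have h1 : HasDerivAt (fun t : ℝ => H (t • ξ)) (fderiv ℝ H ξ ξ) 1 := by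
      have := hd.comp_hasDerivAt (1 : ℝ) ((hasDerivAt_id (1 : ℝ)).smul_const ξ)
      simpa [Function.comp_def] using this
    have h2 : HasDerivAt (fun t : ℝ => H (t • ξ)) (H ξ) 1 := by
      have := (hasDerivAt_id (1 : ℝ)).mul_const (H ξ)
      rw [one_mul] at this
      refine this.congr_of_eventuallyEq ?_
      filter_upwards [Ioi_mem_nhds (zero_lt_one' ℝ)] with t ht
      exact hH.map_smul_of_pos ht ξ
    rw [← h1.unique h2, gradient, InnerProductSpace.toDual_symm_apply]

lemma contDiffAt_gradient (hH : IsFinslerNorm H) {ξ : EuclideanSpace ℝ (Fin N)} (hξ : ξ ≠ 0) :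
    ContDiffAt ℝ 1 (gradient H) ξ :=
  ((InnerProductSpace.toDual ℝ _).symm.contDiff.contDiffAt).comp ξ
    ((hH.contDiffAt hξ).fderiv_right (m := 1) (by norm_num))

lemma differentiableAt_gradient (hH : IsFinslerNorm H) {ξ : EuclideanSpace ℝ (Fin N)}
    (hξ : ξ ≠ 0) : DifferentiableAt ℝ (gradient H) ξ :=
  (hH.contDiffAt_gradient hξ).differentiableAt (by norm_num)

lemma hessian_apply_self (hH : IsFinslerNorm H) {ξ : EuclideanSpace ℝ (Fin N)} (hξ : ξ ≠ 0) :
    fderiv ℝ (gradient H) ξ ξ = 0 := by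
  have hd : HasFDerivAt (gradient H) (fderiv ℝ (gradient H) ξ) ((1 : ℝ) • ξ) := by
    rw [one_smul]
    exact (hH.differentiableAt_gradient hξ).hasFDerivAt
  have h1 : HasDerivAt (fun t : ℝ => gradient H (t • ξ)) (fderiv ℝ (gradient H) ξ ξ) 1 := by
    have := hd.comp_hasDerivAt (1 : ℝ) ((hasDerivAt_id (1 : ℝ)).smul_const ξ)
    simpa [Function.comp_def] using this
  have h2 : HasDerivAt (fun t : ℝ => gradient H (t • ξ)) 0 1 := by
    refine (hasDerivAt_const (1 : ℝ) (gradient H ξ)).congr_of_eventuallyEq ?_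
    filter_upwards [Ioi_mem_nhds (zero_lt_one' ℝ)] with t ht
    exact hH.gradient_smul ht ξ
  exact h1.unique h2

lemma inner_hessian_self (hH : IsFinslerNorm H) {ξ : EuclideanSpace ℝ (Fin N)} (hξ : ξ ≠ 0)
    (v : EuclideanSpace ℝ (Fin N)) : ⟪fderiv ℝ (gradient H) ξ v, ξ⟫ = 0 := by
  have h1 := fderiv_inner_apply ℝ (hH.differentiableAt_gradient hξ) differentiableAt_id v
  have h2 : (fun x => ⟪gradient H x, id x⟫) = H := funext hH.inner_gradient_self
  rw [h2] at h1
  have h3 : fderiv ℝ H ξ v = ⟪gradient H ξ, v⟫ := by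
    rw [gradient, InnerProductSpace.toDual_symm_apply]
  rw [h3] at h1
  simp at h1
  exact h1

lemma inner_hessian_smul_add (hH : IsFinslerNorm H) {ξ : EuclideanSpace ℝ (Fin N)} (hξ : ξ ≠ 0)
    (a : ℝ) (w : EuclideanSpace ℝ (Fin N)) :
    ⟪fderiv ℝ (gradient H) ξ (a • ξ + w), a • ξ + w⟫ = ⟪fderiv ℝ (gradient H) ξ w, w⟫ := by
  rw [map_add, map_smul, hH.hessian_apply_self hξ, smul_zero, zero_add, inner_add_right,
    inner_smul_right, hH.inner_hessian_self hξ, mul_zero, zero_add]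

lemma exists_hessian_bound (hH : IsFinslerNorm H) : ∃ M : ℝ, 0 ≤ M ∧ ∀ ξ w,
    H ξ * |⟪fderiv ℝ (gradient H) ξ w, w⟫| ≤ M * ‖w‖ ^ 2 := by
  obtain ⟨L, hL0, hL⟩ := hH.exists_le_norm
  obtain ⟨M, hM⟩ := (isCompact_sphere (0 : EuclideanSpace ℝ (Fin N)) 1).exists_bound_of_continuousOn
    (f := fderiv ℝ (gradient H)) fun x hx => ContinuousAt.continuousWithinAt (by
      have hx0 : x ≠ 0 := by rintro rfl; simp at hx
      exact ((hH.contDiffAt_gradient hx0).fderiv_right (m := 0) (by norm_num)).continuousAt)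
  refine ⟨L * max M 0, by positivity, fun ξ w => ?_⟩
  rcases eq_or_ne ξ 0 with rfl | hξ
  · rw [hH.map_zero]; simp; positivity
  · have hξ' : 0 < ‖ξ‖ := norm_pos_iff.2 hξ
    have h1 := hM (‖ξ‖⁻¹ • ξ) (by simp [norm_smul, hξ'.ne'])
    have h2 := fderiv_comp_smul (𝕜 := ℝ) (f := gradient H) (x := ξ) (c := ‖ξ‖⁻¹)
    rw [funext fun x => hH.gradient_smul (inv_pos.2 hξ') x] at h2
    have h3 : ‖ξ‖ * ‖fderiv ℝ (gradient H) ξ‖ ≤ max M 0 := by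
      rw [h2, norm_smul, norm_inv, norm_norm, mul_inv_cancel_left₀ hξ'.ne']
      exact h1.trans (le_max_left _ _)
    calc H ξ * |⟪fderiv ℝ (gradient H) ξ w, w⟫|
        ≤ (L * ‖ξ‖) * ((‖fderiv ℝ (gradient H) ξ‖ * ‖w‖) * ‖w‖) := by
          gcongr
          · exact hL ξ
          · refine (abs_real_inner_le_norm _ _).trans ?_
            gcongr
            exact ContinuousLinearMap.le_opNorm _ _
      _ = L * (‖ξ‖ * ‖fderiv ℝ (gradient H) ξ‖) * ‖w‖ ^ 2 := by ring
      _ ≤ L * max M 0 * ‖w‖ ^ 2 := by gcongr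

end IsFinslerNorm

lemma one_add_mul_rpow_mul_sq_le {p c y : ℝ} (hp : 2 ≤ p) (hc : 0 ≤ c) (hy : 0 ≤ y) :
    (1 + c * y) ^ (p - 2) * y ^ 2 ≤ (1 + c) ^ (p - 2) * (y ^ 2 + y ^ p) := by
  have hp' : 0 ≤ p - 2 := by linarith
  have hyp : 0 ≤ y ^ p := Real.rpow_nonneg hy p
  have hcp : 0 ≤ (1 + c) ^ (p - 2) := Real.rpow_nonneg (by linarith) _
  rcases le_total y 1 with h | h
  · have h1 : (1 + c * y) ^ (p - 2) ≤ (1 + c) ^ (p - 2) :=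
      Real.rpow_le_rpow (by positivity) (by nlinarith) hp'
    nlinarith [mul_le_mul_of_nonneg_right h1 (sq_nonneg y), mul_nonneg hcp hyp]
  · have h1 : (1 + c * y) ^ (p - 2) ≤ (1 + c) ^ (p - 2) * y ^ (p - 2) := by
      rw [← Real.mul_rpow (by linarith) hy]
      exact Real.rpow_le_rpow (by positivity) (by nlinarith) hp'
    have h2 : y ^ (p - 2) * y ^ 2 = y ^ p := by
      rw [← Real.rpow_natCast, ← Real.rpow_add (by linarith)]
      norm_num
    have h3 := mul_le_mul_of_nonneg_right h1 (sq_nonneg y)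
    rw [mul_assoc, h2] at h3
    nlinarith [mul_nonneg hcp (sq_nonneg y)]

/-- Absorption of the lower order terms of a quadratic form weighted by `(κ + h) ^ (p - 2)`. -/
lemma exists_weighted_quadratic_lower_bound {p c₀ c₁ c₂ : ℝ} (hp : 2 ≤ p) (h₀ : 0 < c₀)
    (h₁ : 0 ≤ c₁) (h₂ : 0 ≤ c₂) : ∃ C : ℝ, 0 ≤ C ∧ ∀ κ h y : ℝ, 0 ≤ κ → κ ≤ 1 → 0 ≤ h → 0 ≤ y →
      -(C * (y ^ 2 + y ^ p)) ≤ (κ + h) ^ (p - 2) * (c₀ * h ^ 2 - c₁ * (h * y) - c₂ * y ^ 2) := by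
  set c : ℝ := (c₁ + c₂) / c₀ + 1 with hc
  have hc1 : 1 ≤ c := by rw [hc]; linarith [show 0 ≤ (c₁ + c₂) / c₀ by positivity]
  have hcc : c₁ + c₂ ≤ c₀ * c := by rw [hc]; field_simp; linarith
  refine ⟨(c₁ * c + c₂) * (1 + c) ^ (p - 2), by positivity, fun κ h y hκ hκ1 hh hy => ?_⟩
  have hW : 0 ≤ (κ + h) ^ (p - 2) := Real.rpow_nonneg (by linarith) _
  have hyp : 0 ≤ y ^ p := Real.rpow_nonneg hy p
  rcases le_total (c * y) h with hcase | hcase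
  · have hyh : y ≤ h := by nlinarith
    have : 0 ≤ c₀ * h ^ 2 - c₁ * (h * y) - c₂ * y ^ 2 := by
      have e1 : c₀ * (c * y) * h ≤ c₀ * h * h := by gcongr
      have e2 : (c₁ + c₂) * (y * h) ≤ c₀ * c * (y * h) := by gcongr
      have e3 : c₂ * (y * y) ≤ c₂ * (y * h) := by gcongr
      nlinarith
    have h1 : 0 ≤ (c₁ * c + c₂) * (1 + c) ^ (p - 2) * (y ^ 2 + y ^ p) := by positivity
    have h2 := mul_nonneg hW this
    linarith
  · have h1 : -((c₁ * c + c₂) * y ^ 2) ≤ c₀ * h ^ 2 - c₁ * (h * y) - c₂ * y ^ 2 := by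
      have e1 : c₁ * (h * y) ≤ c₁ * ((c * y) * y) := by gcongr
      nlinarith [mul_nonneg h₀.le (sq_nonneg h)]
    have h2 : (κ + h) ^ (p - 2) ≤ (1 + c * y) ^ (p - 2) :=
      Real.rpow_le_rpow (by linarith) (by linarith) (by linarith)
    have h3 := one_add_mul_rpow_mul_sq_le (p := p) hp (by linarith : 0 ≤ c) hy
    have h4 := mul_le_mul_of_nonneg_left h1 hW
    have h5 : (κ + h) ^ (p - 2) * y ^ 2 ≤ (1 + c) ^ (p - 2) * (y ^ 2 + y ^ p) :=
      (mul_le_mul_of_nonneg_right h2 (sq_nonneg y)).trans h3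
    have h6 := mul_le_mul_of_nonneg_left h5 (by positivity : 0 ≤ c₁ * c + c₂)
    linarith

lemma exists_linearized_lower_bound {N : ℕ} {H : EuclideanSpace ℝ (Fin N) → ℝ} {B : ℝ → ℝ}
    {p κ γ Γ α β k : ℝ} (hH : IsFinslerNorm H) (hB : SatisfiesHB B p κ γ Γ) (hp : 2 ≤ p)
    (hk : 0 ≤ k) (hα : 0 ≤ α) (hβ : 0 ≤ β) (hc : β ^ 2 * (Γ * (p - 1)) < k * α * γ) :
    ∃ C : ℝ, 0 ≤ C ∧ ∀ (ξ v : EuclideanSpace ℝ (Fin N)) (s : ℝ),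
      -(C * ((|s| * ‖v‖) ^ 2 + (|s| * ‖v‖) ^ p)) ≤
        k * (deriv B (H ξ) * ⟪gradient H ξ, α • ξ + (2 * s) • v⟫)
        - deriv (deriv B) (H ξ) * ⟪gradient H ξ, β • ξ + s • v⟫ ^ 2
        - deriv B (H ξ) * ⟪fderiv ℝ (gradient H) ξ (β • ξ + s • v), β • ξ + s • v⟫ := by
  obtain ⟨-, -, hB0, hBpos, -, hκ0, hκ1, hγ, hΓ, hB1, hB2⟩ := hB
  obtain ⟨L, hL0, hL⟩ := hH.exists_gradient_bound
  obtain ⟨M, hM0, hM⟩ := hH.exists_hessian_bound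
  have hp1 : 0 ≤ p - 1 := by linarith
  obtain ⟨C, hC0, hC⟩ := exists_weighted_quadratic_lower_bound (p := p)
    (c₀ := k * α * γ - β ^ 2 * (Γ * (p - 1)))
    (c₁ := 2 * k * Γ * L + 2 * (Γ * (p - 1)) * β * L)
    (c₂ := Γ * (p - 1) * L ^ 2 + Γ * M) hp (by linarith) (by positivity) (by positivity)
  refine ⟨C, hC0, fun ξ v s => ?_⟩
  rcases eq_or_ne ξ 0 with rfl | hξ
  · have : 0 ≤ C * ((|s| * ‖v‖) ^ 2 + (|s| * ‖v‖) ^ p) := by positivity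
    simp only [hH.map_zero, hB0, hH.gradient_zero, inner_zero_left]
    linarith
  have hh : 0 < H ξ := lt_of_le_of_ne (hH.nonneg ξ) fun h => hξ ((hH.1 ξ).1 h.symm)
  rw [hH.inner_hessian_smul_add hξ]
  simp only [inner_add_right, inner_smul_right, map_smul, inner_smul_left, hH.inner_gradient_self]
  have hy0 : 0 ≤ |s| * ‖v‖ := by positivity
  refine (hC κ (H ξ) (|s| * ‖v‖) hκ0 hκ1 hh.le hy0).trans ?_
  have hz : |s * ⟪gradient H ξ, v⟫| ≤ L * (|s| * ‖v‖) := by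
    rw [abs_mul]
    nlinarith [mul_le_mul_of_nonneg_left (hL ξ v) (abs_nonneg s)]
  have hD : H ξ * (s ^ 2 * ⟪fderiv ℝ (gradient H) ξ v, v⟫) ≤ M * (|s| * ‖v‖) ^ 2 := by
    have h1 := mul_le_mul_of_nonneg_left ((mul_le_mul_of_nonneg_left (le_abs_self _) hh.le).trans
      (hM ξ v)) (sq_nonneg s)
    rw [mul_pow, sq_abs]
    linarith
  obtain ⟨hb1, hb2⟩ := hB1 _ hh
  obtain ⟨-, hbb2⟩ := hB2 _ hh
  obtain ⟨-, hb0, hbb0⟩ := hBpos _ hh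
  have hW : 0 < (κ + H ξ) ^ (p - 2) := Real.rpow_pos_of_pos (by linarith) _
  set W := (κ + H ξ) ^ (p - 2)
  set h := H ξ
  set y := |s| * ‖v‖
  set b := deriv B h
  set b' := deriv (deriv B) h
  set z := s * ⟪gradient H ξ, v⟫ with hz'
  set D := s ^ 2 * ⟪fderiv ℝ (gradient H) ξ v, v⟫ with hD'
  have e1 : k * α * (γ * W * h) * h ≤ k * α * b * h := by gcongr
  have e2 : -(2 * k * (Γ * W * h) * (L * y)) ≤ 2 * k * b * z := by
    have h1 : |2 * k * b * z| ≤ 2 * k * (Γ * W * h) * (L * y) := by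
      rw [abs_mul, abs_of_nonneg (by positivity : 0 ≤ 2 * k * b)]
      gcongr
    linarith [neg_abs_le (2 * k * b * z)]
  have e3 : b' * (β * h + z) ^ 2 ≤ Γ * (p - 1) * W * (β * h + L * y) ^ 2 := by
    have h1 : (β * h + z) ^ 2 ≤ (β * h + L * y) ^ 2 := by
      refine sq_le_sq' ?_ ?_
      · nlinarith [neg_abs_le z, mul_nonneg hβ hh.le]
      · nlinarith [le_abs_self z]
    gcongr
  have e4 : b * D ≤ Γ * W * (M * y ^ 2) := by
    rcases le_total D 0 with hd | hd
    · have : b * D ≤ 0 := mul_nonpos_of_nonneg_of_nonpos hb0.le hd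
      exact this.trans (by positivity)
    · calc b * D ≤ Γ * W * h * D := by gcongr
        _ = Γ * W * (h * D) := by ring
        _ ≤ _ := by gcongr
  have e5 : k * (b * (α * h + 2 * s * ⟪gradient H ξ, v⟫)) = k * α * b * h + 2 * k * b * z := by
    rw [hz']; ring
  have e6 : b * (s * (s * ⟪fderiv ℝ (gradient H) ξ v, v⟫)) = b * D := by rw [hD']; ring
  simp only [conj_trivial]
  rw [e5, e6]
  linarith

lemma exists_rpow_mul_le_add {a b ε : ℝ} (ha : 0 < a) (hab : a < b) (hε : 0 < ε) :
    ∃ C : ℝ, 0 ≤ C ∧ ∀ t μ : ℝ, 0 ≤ t → 0 ≤ μ →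
      t ^ a * μ ≤ ε * t ^ b + C * μ ^ (b / (b - a)) := by
  have hba : 0 < b - a := by linarith
  refine ⟨(ε⁻¹) ^ (a / (b - a)), by positivity, fun t μ ht hμ => ?_⟩
  have hμ' : 0 ≤ μ ^ (b / (b - a)) := Real.rpow_nonneg hμ _
  rcases le_total μ (ε * t ^ (b - a)) with h | h
  · have h1 : t ^ a * μ ≤ t ^ a * (ε * t ^ (b - a)) := by gcongr
    have h2 : t ^ a * t ^ (b - a) = t ^ b := by
      rw [← Real.rpow_add_of_nonneg ht ha.le hba.le]; congr 1; ring
    have h3 : 0 ≤ (ε⁻¹) ^ (a / (b - a)) * μ ^ (b / (b - a)) := by positivity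
    calc t ^ a * μ ≤ ε * (t ^ a * t ^ (b - a)) := by linarith
      _ ≤ _ := by rw [h2]; linarith
  · have h1 : t ^ (b - a) ≤ ε⁻¹ * μ := by
      rw [inv_mul_eq_div, le_div_iff₀ hε]; linarith
    have h2 : t ^ a ≤ (ε⁻¹ * μ) ^ (a / (b - a)) := by
      have := Real.rpow_le_rpow (Real.rpow_nonneg ht _) h1 (by positivity : 0 ≤ a / (b - a))
      rwa [← Real.rpow_mul ht, mul_div_cancel₀ _ hba.ne'] at this
    have h3 : μ ^ (a / (b - a)) * μ = μ ^ (b / (b - a)) := by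
      have := Real.rpow_add_of_nonneg hμ (by positivity : 0 ≤ a / (b - a)) zero_le_one
      rw [Real.rpow_one] at this
      rw [← this]; congr 1; field_simp; ring
    calc t ^ a * μ ≤ (ε⁻¹ * μ) ^ (a / (b - a)) * μ := by gcongr
      _ = (ε⁻¹) ^ (a / (b - a)) * μ ^ (b / (b - a)) := by
          rw [Real.mul_rpow (by positivity) hμ, mul_assoc, h3]
      _ ≤ _ := by linarith [show 0 ≤ ε * t ^ b by positivity]

lemma exists_weight_absorption {α p q ε : ℝ} (hα : 1 < α) (hp : 2 ≤ p) (hpq : p - 1 < q)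
    (hε : 0 < ε) : ∃ C : ℝ, 0 ≤ C ∧ ∀ t l : ℝ, 0 ≤ t → 0 ≤ l →
      t ^ (α - 1) * ((t * l) ^ 2 + (t * l) ^ p) ≤ ε * t ^ (q + α) +
        C * (l ^ (2 * (q + α) / (q - 1)) + l ^ (p * (q + α) / (q - p + 1))) := by
  obtain ⟨C₁, hC₁, h₁⟩ := exists_rpow_mul_le_add (a := α + 1) (b := q + α) (ε := ε / 2)
    (by linarith) (by linarith) (by linarith)
  obtain ⟨C₂, hC₂, h₂⟩ := exists_rpow_mul_le_add (a := α + p - 1) (b := q + α) (ε := ε / 2)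
    (by linarith) (by linarith) (by linarith)
  refine ⟨C₁ + C₂, by positivity, fun t l ht hl => ?_⟩
  have e₁ := h₁ t (l ^ (2 : ℝ)) ht (by positivity)
  have e₂ := h₂ t (l ^ p) ht (by positivity)
  rw [← Real.rpow_mul hl] at e₁ e₂
  rw [show 2 * ((q + α) / (q + α - (α + 1))) = 2 * (q + α) / (q - 1) by
    rw [mul_div_assoc]; ring_nf] at e₁
  rw [show p * ((q + α) / (q + α - (α + p - 1))) = p * (q + α) / (q - p + 1) by
    rw [mul_div_assoc]; ring_nf] at e₂
  have f₁ : t ^ (α - 1) * (t * l) ^ 2 = t ^ (α + 1) * l ^ (2 : ℝ) := by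
    rw [← Real.rpow_natCast, Real.mul_rpow ht hl, ← mul_assoc,
      ← Real.rpow_add_of_nonneg ht (by linarith) (by norm_num)]
    norm_num
    left; congr 1; ring
  have f₂ : t ^ (α - 1) * (t * l) ^ p = t ^ (α + p - 1) * l ^ p := by
    rw [Real.mul_rpow ht hl, ← mul_assoc,
      ← Real.rpow_add_of_nonneg ht (by linarith) (by linarith)]
    congr 2; ring
  rw [mul_add, f₁, f₂]
  have g₁ : 0 ≤ l ^ (2 * (q + α) / (q - 1)) := by positivity
  have g₂ : 0 ≤ l ^ (p * (q + α) / (q - p + 1)) := by positivity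
  nlinarith [mul_nonneg hC₁ g₂, mul_nonneg hC₂ g₁]

lemma exists_exponent {n K q : ℝ} (hK : 0 < K) (hKq : K < q) (hq : 1 < q)
    (hn : n < 2 * (K * (q - 1) + 2 * q + 2 * √(q * (q - K))) / (K * (q - 1))) :
    ∃ α : ℝ, 1 < α ∧ n < 2 * (q + α) / (q - 1) ∧ K * (α + 1) ^ 2 < 4 * (q * α) := by
  set r := √(q * (q - K))
  have hr : r ^ 2 = q * (q - K) := Real.sq_sqrt (by nlinarith)
  have hr0 : 0 ≤ r := Real.sqrt_nonneg _
  set σ := (2 * q - K + 2 * r) / K with hσ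
  have hKσ : K * σ = 2 * q - K + 2 * r := by rw [hσ]; field_simp
  have hσ1 : 1 < σ := by
    rw [hσ, lt_div_iff₀ hK]; linarith
  have hσeq : K * (σ + 1) ^ 2 = 4 * (q * σ) := by
    have h1 : K * (K * (σ + 1) ^ 2) = K * (4 * (q * σ)) := by
      have h2 : K * (σ + 1) = 2 * q + 2 * r := by linarith
      calc K * (K * (σ + 1) ^ 2) = (K * (σ + 1)) ^ 2 := by ring
        _ = (2 * q + 2 * r) ^ 2 := by rw [h2]
        _ = 4 * q * (K * σ) := by rw [hKσ]; nlinarith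
        _ = _ := by ring
    exact mul_left_cancel₀ hK.ne' h1
  have hnσ : n * (q - 1) / 2 - q < σ := by
    rw [lt_div_iff₀ (by nlinarith)] at hn
    rw [hσ, lt_div_iff₀ hK]
    linarith
  obtain ⟨α, hα, hασ⟩ := exists_between (max_lt hσ1 hnσ)
  obtain ⟨hα1, hα2⟩ := max_lt_iff.1 hα
  refine ⟨α, hα1, ?_, ?_⟩
  · rw [lt_div_iff₀ (by linarith)]; linarith
  · have h1 : σ * (K * (α + 1) ^ 2) < σ * (4 * (q * α)) := by
      have h2 : 0 < K * ((σ - α) * (α * σ - 1)) :=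
        mul_pos hK (mul_pos (by linarith) (by nlinarith))
      have h3 : α * (K * (σ + 1) ^ 2) = α * (4 * (q * σ)) := by rw [hσeq]
      nlinarith
    exact lt_of_mul_lt_mul_left h1 (by linarith)

/-- Powers of rescaled bump functions: cutoffs whose logarithmic gradient is controlled. -/
lemma exists_cutoff (N m : ℕ) (hm : 2 ≤ m) :
    ∃ (A : ℝ) (ζ : ℝ → EuclideanSpace ℝ (Fin N) → ℝ), 0 ≤ A ∧ ∀ R : ℝ, 0 < R →
      ContDiff ℝ 1 (ζ R) ∧ HasCompactSupport (ζ R) ∧ (∀ x, 0 ≤ ζ R x ∧ ζ R x ≤ 1) ∧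
      (∀ x, ‖x‖ ≤ R → ζ R x = 1) ∧ (∀ x, 2 * R ≤ ‖x‖ → ζ R x = 0) ∧
      ∀ x, ∃ v : EuclideanSpace ℝ (Fin N), gradient (ζ R) x = ζ R x • v ∧
        ∀ τ : ℝ, 0 < τ → τ ≤ 2 * m → ζ R x ^ 2 * ‖v‖ ^ τ ≤ (A / R) ^ τ := by
  let χ : ContDiffBump (0 : EuclideanSpace ℝ (Fin N)) := ⟨1, 2, by norm_num, by norm_num⟩
  have hχ : ContDiff ℝ 1 χ := χ.contDiff
  obtain ⟨M, hM⟩ := (χ.hasCompactSupport.fderiv ℝ).exists_bound_of_continuous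
    (hχ.continuous_fderiv (by norm_num))
  have hM0 : 0 ≤ M := (norm_nonneg _).trans (hM 0)
  refine ⟨m * M, fun R x => χ (R⁻¹ • x) ^ m, by positivity, fun R hR => ?_⟩
  have hnorm : ∀ x : EuclideanSpace ℝ (Fin N), ‖R⁻¹ • x‖ = ‖x‖ / R := fun x => by
    rw [norm_smul, norm_inv, Real.norm_of_nonneg hR.le, inv_mul_eq_div]
  have hsm : ContDiff ℝ 1 (fun x : EuclideanSpace ℝ (Fin N) => χ (R⁻¹ • x) ^ m) :=
    (hχ.comp (contDiff_const_smul R⁻¹)).pow m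
  have hzero : ∀ x : EuclideanSpace ℝ (Fin N), 2 * R ≤ ‖x‖ → χ (R⁻¹ • x) ^ m = 0 := fun x hx => by
    rw [χ.zero_of_le_dist, zero_pow (by omega)]
    rw [dist_zero_right, hnorm, le_div_iff₀ hR]
    exact hx
  refine ⟨hsm, ?_, fun x => ⟨pow_nonneg χ.nonneg m, pow_le_one₀ χ.nonneg χ.le_one⟩,
    fun x hx => ?_, hzero, fun x => ?_⟩
  · refine HasCompactSupport.intro (isCompact_closedBall (0 : EuclideanSpace ℝ (Fin N)) (2 * R))
      fun x hx => hzero x ?_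
    simp at hx
    exact hx.le
  · dsimp only
    rw [χ.one_of_mem_closedBall, one_pow]
    rw [mem_closedBall_zero_iff, hnorm, div_le_iff₀ hR]
    simpa [χ] using hx
  · set θ := χ (R⁻¹ • x) with hθ
    have hθ0 : 0 ≤ θ := χ.nonneg
    have hθ1 : θ ≤ 1 := χ.le_one
    set g : EuclideanSpace ℝ (Fin N) := gradient (fun y => χ (R⁻¹ • y)) x with hg
    have hgM : ‖g‖ ≤ M / R := by
      rw [hg, gradient, LinearIsometryEquiv.norm_map, fderiv_comp_smul, norm_smul, norm_inv,
        Real.norm_of_nonneg hR.le, inv_mul_eq_div]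
      gcongr
      exact hM _
    have hgrad : gradient (fun y : EuclideanSpace ℝ (Fin N) => χ (R⁻¹ • y) ^ m) x
        = (m * θ ^ (m - 1)) • g := by
      have hd : DifferentiableAt ℝ (fun y : EuclideanSpace ℝ (Fin N) => χ (R⁻¹ • y)) x :=
        (hχ.comp (contDiff_const_smul R⁻¹)).differentiable (by norm_num) x
      rw [hg, gradient, gradient, (hd.hasFDerivAt.pow m).fderiv]
      simp [hθ]
    rw [hgrad]
    rcases hθ0.eq_or_lt with h0 | h0
    · refine ⟨0, ?_, fun τ hτ _ => ?_⟩
      · rw [← h0, zero_pow (by omega)]; simp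
      · rw [norm_zero, Real.zero_rpow hτ.ne', mul_zero]; positivity
    · refine ⟨(m / θ) • g, ?_, fun τ hτ hτm => ?_⟩
      · rw [smul_smul]
        congr 1
        dsimp only
        rw [← hθ, ← Nat.sub_add_cancel (by omega : 1 ≤ m), pow_succ]
        field_simp
        simp
      · have h1 : ‖(m / θ) • g‖ ≤ (m * M / R) / θ := by
          rw [norm_smul, Real.norm_of_nonneg (by positivity)]
          calc m / θ * ‖g‖ ≤ m / θ * (M / R) := by gcongr
            _ = _ := by ring
        have h2 : (θ ^ m) ^ 2 ≤ θ ^ τ := by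
          rw [← pow_mul, ← Real.rpow_natCast]
          refine Real.rpow_le_rpow_of_exponent_ge h0 hθ1 ?_
          push_cast; linarith
        calc (θ ^ m) ^ 2 * ‖(m / θ) • g‖ ^ τ ≤ θ ^ τ * ((m * M / R) / θ) ^ τ := by gcongr
          _ = (m * M / R) ^ τ := by
            rw [← Real.mul_rpow h0.le (by positivity)]
            congr 1; field_simp

lemma gradient_comp_mul {N : ℕ} {f : ℝ → ℝ} {f' : ℝ} {u g : EuclideanSpace ℝ (Fin N) → ℝ}
    {x : EuclideanSpace ℝ (Fin N)} (hf : HasDerivAt f f' (u x)) (hu : DifferentiableAt ℝ u x)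
    (hg : DifferentiableAt ℝ g x) :
    gradient (fun y => f (u y) * g y) x = (g x * f') • gradient u x + f (u x) • gradient g x := by
  have h := (hf.comp_hasFDerivAt x hu.hasFDerivAt).mul hg.hasFDerivAt
  have h' : fderiv ℝ (fun y => f (u y) * g y) x
      = f (u x) • fderiv ℝ g x + g x • f' • fderiv ℝ u x := h.fderiv
  simp only [gradient, h', map_add, map_smul, smul_smul]
  rw [add_comm]

lemma continuous_gradient {N : ℕ} {f : EuclideanSpace ℝ (Fin N) → ℝ} (hf : ContDiff ℝ 1 f) :
    Continuous (gradient f) :=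
  (InnerProductSpace.toDual ℝ _).symm.continuous.comp (hf.continuous_fderiv (by norm_num))

lemma hasCompactSupport_gradient {N : ℕ} {f : EuclideanSpace ℝ (Fin N) → ℝ}
    (hf : HasCompactSupport f) : HasCompactSupport (gradient f) :=
  (hf.fderiv ℝ).comp_left (g := (InnerProductSpace.toDual ℝ _).symm) (map_zero _)

lemma measurable_gradient {N : ℕ} (f : EuclideanSpace ℝ (Fin N) → ℝ) : Measurable (gradient f) :=
  (InnerProductSpace.toDual ℝ _).symm.continuous.measurable.comp (measurable_fderiv ℝ f)

section Integrability

variable {N : ℕ} {H : EuclideanSpace ℝ (Fin N) → ℝ} {B : ℝ → ℝ} {p κ γ Γ : ℝ}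
  {U V : EuclideanSpace ℝ (Fin N) → EuclideanSpace ℝ (Fin N)}

lemma continuous_weight (hH : IsFinslerNorm H) (hp : 2 ≤ p) (hU : Continuous U) :
    Continuous fun x => (κ + H (U x)) ^ (p - 2) :=
  (continuous_const.add (hH.continuous.comp hU)).rpow_const fun _ => Or.inr (by linarith)

lemma integrable_flux (hH : IsFinslerNorm H) (hB : SatisfiesHB B p κ γ Γ) (hp : 2 ≤ p)
    (hU : Continuous U) (hV : Continuous V) (hVc : HasCompactSupport V) :
    Integrable fun x => deriv B (H (U x)) * ⟪gradient H (U x), V x⟫ := by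
  obtain ⟨-, -, hB0, hBpos, -, hκ0, -, -, hΓ, hB1, -⟩ := hB
  obtain ⟨L, hL0, hL⟩ := hH.exists_gradient_bound
  have hdom : Integrable fun x => Γ * (κ + H (U x)) ^ (p - 2) * H (U x) * (L * ‖V x‖) := by
    refine Continuous.integrable_of_hasCompactSupport ?_ ?_
    · exact ((continuous_const.mul (continuous_weight hH hp hU)).mul
        (hH.continuous.comp hU)).mul (continuous_const.mul hV.norm)
    · exact (hVc.norm.mul_left (f := fun _ => L)).mul_left
  refine hdom.mono' ?_ (Filter.Eventually.of_forall fun x => ?_)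
  · exact (((measurable_deriv B).comp (hH.continuous.comp hU).measurable).mul
      (((measurable_gradient H).comp hU.measurable).inner hV.measurable)).aestronglyMeasurable
  · rw [Real.norm_eq_abs, abs_mul]
    refine mul_le_mul ?_ (hL _ _) (abs_nonneg _) ?_
    · rcases (hH.nonneg (U x)).eq_or_lt with h | h
      · rw [← h, hB0]; simp
      · rw [abs_of_pos (hBpos _ h).2.1]; exact (hB1 _ h).2
    · have := hH.nonneg (U x)
      positivity

lemma integrable_radial_hessian (hH : IsFinslerNorm H) (hB : SatisfiesHB B p κ γ Γ) (hp : 2 ≤ p)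
    (hU : Continuous U) (hV : Continuous V) (hVc : HasCompactSupport V) :
    Integrable fun x => deriv (deriv B) (H (U x)) * ⟪gradient H (U x), V x⟫ ^ 2 := by
  obtain ⟨-, -, -, hBpos, -, hκ0, -, -, hΓ, -, hB2⟩ := hB
  obtain ⟨L, hL0, hL⟩ := hH.exists_gradient_bound
  have hdom : Integrable fun x => Γ * (p - 1) * (κ + H (U x)) ^ (p - 2) * (L * ‖V x‖) ^ 2 := by
    refine Continuous.integrable_of_hasCompactSupport ?_ ?_
    · exact (continuous_const.mul (continuous_weight hH hp hU)).mul
        ((continuous_const.mul hV.norm).pow 2)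
    · exact ((hVc.norm.mul_left (f := fun _ => L)).comp_left (g := fun t : ℝ => t ^ 2)
        (by norm_num)).mul_left
  refine hdom.mono' ?_ (Filter.Eventually.of_forall fun x => ?_)
  · exact (((measurable_deriv (deriv B)).comp (hH.continuous.comp hU).measurable).mul
      ((((measurable_gradient H).comp hU.measurable).inner hV.measurable).pow_const
        2)).aestronglyMeasurable
  · rcases (hH.nonneg (U x)).eq_or_lt with h | h
    · have h0 : U x = 0 := (hH.1 _).1 h.symm
      rw [h0, hH.gradient_zero, inner_zero_left]
      simp only [ne_eq, OfNat.ofNat_ne_zero, not_false_eq_true, zero_pow, mul_zero, norm_zero]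
      have : 0 ≤ p - 1 := by linarith
      have := hH.nonneg 0
      positivity
    · rw [Real.norm_eq_abs, abs_mul, abs_of_pos (hBpos _ h).2.2, abs_pow]
      have := (hB2 _ h).2
      have h1 := hL (U x) (V x)
      have : 0 ≤ p - 1 := by linarith
      gcongr

lemma integrable_tangential_hessian (hH : IsFinslerNorm H) (hB : SatisfiesHB B p κ γ Γ)
    (hp : 2 ≤ p) (hU : Continuous U) (hV : Continuous V) (hVc : HasCompactSupport V) :
    Integrable fun x => deriv B (H (U x)) * ⟪fderiv ℝ (gradient H) (U x) (V x), V x⟫ := by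
  obtain ⟨-, -, hB0, hBpos, -, hκ0, -, -, hΓ, hB1, -⟩ := hB
  obtain ⟨M, hM0, hM⟩ := hH.exists_hessian_bound
  have hdom : Integrable fun x => Γ * (κ + H (U x)) ^ (p - 2) * (M * ‖V x‖ ^ 2) := by
    refine Continuous.integrable_of_hasCompactSupport ?_ ?_
    · exact (continuous_const.mul (continuous_weight hH hp hU)).mul
        (continuous_const.mul (hV.norm.pow 2))
    · exact ((hVc.norm.comp_left (g := fun t : ℝ => t ^ 2) (by norm_num)).mul_left
        (f := fun _ => M)).mul_left
  refine hdom.mono' ?_ (Filter.Eventually.of_forall fun x => ?_)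
  · have h1 : Measurable fun x => fderiv ℝ (gradient H) (U x) (V x) :=
      (isBoundedBilinearMap_apply (𝕜 := ℝ) (E := EuclideanSpace ℝ (Fin N))
        (F := EuclideanSpace ℝ (Fin N))).continuous.measurable.comp
        (((measurable_fderiv ℝ (gradient H)).comp hU.measurable).prodMk hV.measurable)
    exact (((measurable_deriv B).comp (hH.continuous.comp hU).measurable).mul
      (h1.inner hV.measurable)).aestronglyMeasurable
  · have hh := hH.nonneg (U x)
    rw [Real.norm_eq_abs, abs_mul]
    rcases hh.eq_or_lt with h | h
    · rw [← h, hB0, abs_zero, zero_mul]; positivity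
    · rw [abs_of_pos (hBpos _ h).2.1]
      calc _ ≤ Γ * (κ + H (U x)) ^ (p - 2) * H (U x) *
            |⟪fderiv ℝ (gradient H) (U x) (V x), V x⟫| := by
            gcongr; exact (hB1 _ h).2
        _ = Γ * (κ + H (U x)) ^ (p - 2) *
            (H (U x) * |⟪fderiv ℝ (gradient H) (U x) (V x), V x⟫|) := by ring
        _ ≤ _ := mul_le_mul_of_nonneg_left (hM _ _) (by positivity)

end Integrability

lemma exists_energy_estimate {N : ℕ} {H : EuclideanSpace ℝ (Fin N) → ℝ} {B : ℝ → ℝ}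
    {u : EuclideanSpace ℝ (Fin N) → ℝ} {p κ γ Γ q α k : ℝ}
    (hH : IsFinslerNorm H) (hB : SatisfiesHB B p κ γ Γ) (hp : 2 ≤ p)
    (hu : ContDiff ℝ 1 u) (hsol : IsWeakSolutionOn Set.univ B H u q)
    (hstab : IsStableOn Set.univ Set.univ B H u q) (hq : 1 < q) (hpq : p - 1 < q)
    (hα : 1 < α) (hk : 0 ≤ k) (hkq : k < q)
    (hc : ((α + 1) / 2) ^ 2 * (Γ * (p - 1)) < k * α * γ) :
    ∃ D : ℝ, 0 ≤ D ∧ ∀ (ζ : EuclideanSpace ℝ (Fin N) → ℝ) (ρ r : ℝ),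
      ContDiff ℝ 1 ζ → HasCompactSupport ζ → (∀ x, r ≤ ‖x‖ → ζ x = 0) →
      (∀ x, ∃ v, gradient ζ x = ζ x • v ∧
        ζ x ^ 2 * (‖v‖ ^ (2 * (q + α) / (q - 1)) + ‖v‖ ^ (p * (q + α) / (q - p + 1))) ≤ ρ) →
      ∫ x, |u x| ^ (q + α) * ζ x ^ 2
        ≤ D * ρ * (volume (Metric.closedBall (0 : EuclideanSpace ℝ (Fin N)) r)).toReal := by
  obtain ⟨C, hC0, hC⟩ := exists_linearized_lower_bound hH hB hp hk (by linarith : 0 ≤ α)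
    (by linarith : 0 ≤ (α + 1) / 2) hc
  have hε : 0 < (q - k) / (2 * (C + 1)) := div_pos (by linarith) (by linarith)
  obtain ⟨C', hC'0, hC'⟩ := exists_weight_absorption hα hp hpq hε
  have hCε : C * ((q - k) / (2 * (C + 1))) ≤ (q - k) / 2 := by
    rw [mul_div_assoc', div_le_div_iff₀ (by linarith) (by norm_num)]
    nlinarith
  refine ⟨2 * (C * C') / (q - k), div_nonneg (by positivity) (by linarith),
    fun ζ ρ r hζ hζc hζr hζv => ?_⟩
  have hud : ∀ x, DifferentiableAt ℝ u x := hu.differentiable (by norm_num)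
  have hζd : ∀ x, DifferentiableAt ℝ ζ x := hζ.differentiable (by norm_num)
  set φ : EuclideanSpace ℝ (Fin N) → ℝ := fun x => |u x| ^ (α - 1) * u x * ζ x ^ 2 with hφdef
  set ψ : EuclideanSpace ℝ (Fin N) → ℝ := fun x => |u x| ^ ((α - 1) / 2) * u x * ζ x with hψdef
  have hφ : ContDiff ℝ 1 φ :=
    ((contDiff_abs_rpow_mul_self (by linarith : 0 < α - 1)).comp hu).mul (hζ.pow 2)
  have hψ : ContDiff ℝ 1 ψ :=
    ((contDiff_abs_rpow_mul_self (by linarith : 0 < (α - 1) / 2)).comp hu).mul hζ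
  have hζ2c : HasCompactSupport fun x => ζ x ^ 2 :=
    hζc.comp_left (g := fun t : ℝ => t ^ 2) (by norm_num)
  have hφc : HasCompactSupport φ := hζ2c.mul_left
  have hψc : HasCompactSupport ψ := hζc.mul_left
  have hgζ2 : ∀ x, gradient (fun y => ζ y ^ 2) x = (2 * ζ x) • gradient ζ x := fun x => by
    rw [gradient, gradient, ((hζd x).hasFDerivAt.pow 2).fderiv]
    simp
  have hgφ : ∀ x, gradient φ x = (ζ x ^ 2 * (α * |u x| ^ (α - 1))) • gradient u x
      + (|u x| ^ (α - 1) * u x) • ((2 * ζ x) • gradient ζ x) := fun x => by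
    have := gradient_comp_mul (g := fun y => ζ y ^ 2)
      (hasDerivAt_abs_rpow_mul_self (by linarith : 0 < α - 1) (u x)) (hud x) ((hζd x).pow 2)
    rw [hgζ2, sub_add_cancel] at this
    exact this
  have hgψ : ∀ x, gradient ψ x = (ζ x * ((α + 1) / 2 * |u x| ^ ((α - 1) / 2))) • gradient u x
      + (|u x| ^ ((α - 1) / 2) * u x) • gradient ζ x := fun x => by
    have := gradient_comp_mul (g := ζ)
      (hasDerivAt_abs_rpow_mul_self (by linarith : 0 < (α - 1) / 2) (u x)) (hud x) (hζd x)
    rw [show (α - 1) / 2 + 1 = (α + 1) / 2 by ring] at this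
    exact this
  have hsol' := hsol φ hφ hφc (Set.subset_univ _)
  have hstab' := hstab ψ hψ hψc (Set.subset_univ _)
  simp only [Measure.restrict_univ] at hsol' hstab'
  have hGu := continuous_gradient hu
  have hI₁ := integrable_flux hH hB hp hGu (continuous_gradient hφ) (hasCompactSupport_gradient hφc)
  have hI₂ := integrable_radial_hessian hH hB hp hGu (continuous_gradient hψ)
    (hasCompactSupport_gradient hψc)
  have hI₃ := integrable_tangential_hessian hH hB hp hGu (continuous_gradient hψ)
    (hasCompactSupport_gradient hψc)
  have hIY : Integrable fun x => |u x| ^ (q + α) * ζ x ^ 2 :=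
    Continuous.integrable_of_hasCompactSupport
      ((hu.continuous.abs.rpow_const fun _ => Or.inr (by linarith)).mul (hζ.continuous.pow 2))
      hζ2c.mul_left
  have hYφ : ∀ x, |u x| ^ (q - 1) * u x * φ x = |u x| ^ (q + α) * ζ x ^ 2 := fun x => by
    have h1 : |u x| ^ (q + α) = |u x| ^ (q - 1) * |u x| ^ (α - 1) * |u x| ^ 2 := by
      rw [← Real.rpow_natCast, ← Real.rpow_add_of_nonneg (abs_nonneg _) (by linarith)
        (by linarith), ← Real.rpow_add_of_nonneg (abs_nonneg _) (by linarith) (by norm_num)]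
      congr 1; push_cast; ring
    rw [h1, sq_abs, hφdef]; ring
  have hsq : ∀ x, (|u x| ^ ((α - 1) / 2)) ^ 2 = |u x| ^ (α - 1) := fun x => by
    rw [← Real.rpow_natCast, ← Real.rpow_mul (abs_nonneg _)]
    congr 1; push_cast; ring
  have hYψ : ∀ x, q * |u x| ^ (q - 1) * ψ x ^ 2 = q * (|u x| ^ (q + α) * ζ x ^ 2) := fun x => by
    rw [← hYφ x, hψdef, hφdef]
    simp only [mul_pow, hsq]
    ring
  simp only [hYφ] at hsol'
  simp only [hYψ, integral_const_mul] at hstab'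
  have hball : Integrable ((Metric.closedBall (0 : EuclideanSpace ℝ (Fin N)) r).indicator
      fun _ => C * C' * ρ) :=
    (integrable_indicator_iff Metric.isClosed_closedBall.measurableSet).2
      (integrableOn_const (measure_closedBall_lt_top.ne))
  have hpt : ∀ x, -((q - k) / 2 * (|u x| ^ (q + α) * ζ x ^ 2)) -
      (Metric.closedBall (0 : EuclideanSpace ℝ (Fin N)) r).indicator (fun _ => C * C' * ρ) x ≤
      k * (deriv B (H (gradient u x)) * ⟪gradient H (gradient u x), gradient φ x⟫)
      - deriv (deriv B) (H (gradient u x)) * ⟪gradient H (gradient u x), gradient ψ x⟫ ^ 2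
      - deriv B (H (gradient u x)) *
        ⟪fderiv ℝ (gradient H) (gradient u x) (gradient ψ x), gradient ψ x⟫ := fun x => by
    obtain ⟨v, hv, hvρ⟩ := hζv x
    have hind : C * C' * (ζ x ^ 2 * (‖v‖ ^ (2 * (q + α) / (q - 1)) +
        ‖v‖ ^ (p * (q + α) / (q - p + 1)))) ≤
        (Metric.closedBall (0 : EuclideanSpace ℝ (Fin N)) r).indicator (fun _ => C * C' * ρ) x := by
      by_cases hx : x ∈ Metric.closedBall (0 : EuclideanSpace ℝ (Fin N)) r
      · rw [Set.indicator_of_mem hx]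
        gcongr
      · rw [Set.indicator_of_notMem hx, hζr x (by simpa using (not_le.1 (by simpa using hx)).le)]
        simp
    have hgφ' : gradient φ x
        = (ζ x ^ 2 * |u x| ^ (α - 1)) • (α • gradient u x + (2 * u x) • v) := by
      rw [hgφ, hv]; module
    have hgψ' : gradient ψ x = (ζ x * |u x| ^ ((α - 1) / 2)) •
        (((α + 1) / 2) • gradient u x + u x • v) := by
      rw [hgψ, hv]; module
    have hw : (ζ x * |u x| ^ ((α - 1) / 2)) ^ 2 = ζ x ^ 2 * |u x| ^ (α - 1) := by
      rw [mul_pow, hsq]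
    have hw0 : 0 ≤ ζ x ^ 2 * |u x| ^ (α - 1) := by positivity
    have key := mul_le_mul_of_nonneg_left (hC (gradient u x) v (u x)) hw0
    have abs' := mul_le_mul_of_nonneg_left (hC' |u x| ‖v‖ (abs_nonneg _) (norm_nonneg _))
      (mul_nonneg hC0 (sq_nonneg (ζ x)))
    have hY0 : 0 ≤ |u x| ^ (q + α) * ζ x ^ 2 := by positivity
    have hYε := mul_le_mul_of_nonneg_right hCε hY0
    rw [hgφ', hgψ']
    simp only [map_smul, inner_smul_right, inner_smul_left, conj_trivial]
    rw [mul_pow, hw]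
    rw [show ∀ a b c : ℝ, a * (b * (b * c)) = b ^ 2 * (a * c) by intros; ring, hw]
    linarith
  have hneg : Integrable fun x => -((q - k) / 2 * (|u x| ^ (q + α) * ζ x ^ 2)) :=
    (hIY.const_mul ((q - k) / 2)).neg
  have hI₁₂ : Integrable fun x =>
      k * (deriv B (H (gradient u x)) * ⟪gradient H (gradient u x), gradient φ x⟫)
      - deriv (deriv B) (H (gradient u x)) * ⟪gradient H (gradient u x), gradient ψ x⟫ ^ 2 :=
    (hI₁.const_mul k).sub hI₂
  have hint := integral_mono (hneg.sub hball) (hI₁₂.sub hI₃) hpt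
  simp only [Pi.sub_apply] at hint
  rw [integral_sub hneg hball, integral_sub hI₁₂ hI₃, integral_sub (hI₁.const_mul k) hI₂,
    integral_const_mul, hsol', integral_neg, integral_const_mul,
    integral_indicator_const _ Metric.isClosed_closedBall.measurableSet] at hint
  rw [smul_eq_mul, Measure.real] at hint
  set J := ∫ x, |u x| ^ (q + α) * ζ x ^ 2
  have hfin : (q - k) / 2 * J ≤ C * C' * ρ *
      (volume (Metric.closedBall (0 : EuclideanSpace ℝ (Fin N)) r)).toReal := by linarith
  have hqk : 0 < q - k := by linarith
  have : J ≤ (C * C' * ρ *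
      (volume (Metric.closedBall (0 : EuclideanSpace ℝ (Fin N)) r)).toReal) / ((q - k) / 2) := by
    rw [le_div_iff₀ (by linarith)]; linarith
  refine this.trans (le_of_eq ?_)
  field_simp

lemma tendsto_rpow_mul_pow_atTop {n : ℕ} {A c τ : ℝ} (hA : 0 ≤ A) (hτ : (n : ℝ) < τ) :
    Filter.Tendsto (fun R : ℝ => (A / R) ^ τ * (c * R) ^ n) Filter.atTop (nhds 0) := by
  have h1 := (tendsto_rpow_neg_atTop (by linarith : 0 < τ - n)).const_mul (A ^ τ * c ^ n)
  rw [mul_zero] at h1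
  refine h1.congr' ?_
  filter_upwards [Filter.eventually_gt_atTop 0] with R hR
  rw [Real.div_rpow hA hR.le, neg_sub, Real.rpow_sub hR, Real.rpow_natCast, mul_pow]
  ring

lemma eq_zero_of_energy_estimate {N : ℕ} {u : EuclideanSpace ℝ (Fin N) → ℝ}
    {s τ₁ τ₂ D : ℝ} (hu : Continuous u) (hs : 0 < s)
    (hτ₁ : (N : ℝ) < τ₁) (hτ₂ : (N : ℝ) < τ₂)
    (hD : ∀ (ζ : EuclideanSpace ℝ (Fin N) → ℝ) (ρ r : ℝ),
      ContDiff ℝ 1 ζ → HasCompactSupport ζ → (∀ x, r ≤ ‖x‖ → ζ x = 0) →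
      (∀ x, ∃ v, gradient ζ x = ζ x • v ∧ ζ x ^ 2 * (‖v‖ ^ τ₁ + ‖v‖ ^ τ₂) ≤ ρ) →
      ∫ x, |u x| ^ s * ζ x ^ 2
        ≤ D * ρ * (volume (Metric.closedBall (0 : EuclideanSpace ℝ (Fin N)) r)).toReal)
    (x : EuclideanSpace ℝ (Fin N)) : u x = 0 := by
  have hN0 : (0 : ℝ) ≤ N := Nat.cast_nonneg N
  obtain ⟨m, hm⟩ := exists_nat_ge (max τ₁ τ₂)
  obtain ⟨hm₁, hm₂⟩ := max_le_iff.1 hm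
  obtain ⟨A, ζ, hA, hζ⟩ := exists_cutoff N (m + 2) (by omega)
  set J : ℝ → ℝ := fun R => ∫ x, |u x| ^ s * ζ R x ^ 2 with hJ
  set ω := (volume (Metric.ball (0 : EuclideanSpace ℝ (Fin N)) 1)).toReal with hω
  have hcont : ∀ R, 0 < R → Continuous fun x => |u x| ^ s * ζ R x ^ 2 := fun R hR =>
    (hu.abs.rpow_const fun _ => Or.inr hs.le).mul ((hζ R hR).1.continuous.pow 2)
  have hcomp : ∀ R, 0 < R → HasCompactSupport fun x => |u x| ^ s * ζ R x ^ 2 := fun R hR =>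
    ((hζ R hR).2.1.comp_left (g := fun t : ℝ => t ^ 2) (by norm_num)).mul_left
  have hbound : ∀ R, 0 < R →
      J R ≤ D * ω * ((A / R) ^ τ₁ * (2 * R) ^ N + (A / R) ^ τ₂ * (2 * R) ^ N) := fun R hR => by
    obtain ⟨h1, h2, -, -, h5, h6⟩ := hζ R hR
    have h := hD (ζ R) ((A / R) ^ τ₁ + (A / R) ^ τ₂) (2 * R) h1 h2 h5 fun x => by
      obtain ⟨v, hv, hvτ⟩ := h6 x
      refine ⟨v, hv, ?_⟩
      rw [mul_add]
      exact add_le_add (hvτ τ₁ (by linarith) (by push_cast; linarith))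
        (hvτ τ₂ (by linarith) (by push_cast; linarith))
    rw [Measure.addHaar_closedBall _ _ (by linarith : 0 ≤ 2 * R), ENNReal.toReal_mul,
      ENNReal.toReal_ofReal (by positivity), finrank_euclideanSpace_fin] at h
    refine h.trans (le_of_eq ?_)
    ring
  have hlim : Filter.Tendsto
      (fun R : ℝ => D * ω * ((A / R) ^ τ₁ * (2 * R) ^ N + (A / R) ^ τ₂ * (2 * R) ^ N))
      Filter.atTop (nhds 0) := by
    have := ((tendsto_rpow_mul_pow_atTop (c := 2) hA hτ₁).add
      (tendsto_rpow_mul_pow_atTop (c := 2) hA hτ₂)).const_mul (D * ω)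
    simpa using this
  have hJ0 : ∀ r, 0 < r → J r ≤ 0 := fun r hr => by
    refine ge_of_tendsto hlim ?_
    filter_upwards [Filter.eventually_ge_atTop (2 * r)] with R hR
    have hR0 : 0 < R := by linarith
    refine le_trans ?_ (hbound R hR0)
    refine integral_mono ((hcont r hr).integrable_of_hasCompactSupport (hcomp r hr))
      ((hcont R hR0).integrable_of_hasCompactSupport (hcomp R hR0)) fun y => ?_
    have hle : ζ r y ≤ ζ R y := by
      rcases le_total ‖y‖ R with hy | hy
      · rw [(hζ R hR0).2.2.2.1 y hy]; exact ((hζ r hr).2.2.1 y).2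
      · rw [(hζ r hr).2.2.2.2.1 y (hR.trans hy)]; exact ((hζ R hR0).2.2.1 y).1
    have := ((hζ r hr).2.2.1 y).1
    dsimp only
    gcongr
  by_contra hx
  have hr : 0 < ‖x‖ + 1 := by positivity
  refine (hJ0 _ hr).not_gt ?_
  refine (hcont _ hr).integral_pos_of_hasCompactSupport_nonneg_nonzero (hcomp _ hr)
    (fun y => by positivity) (x := x) ?_
  rw [(hζ _ hr).2.2.2.1 x (by linarith)]
  have := abs_pos.2 hx
  positivity

/-- Theorem 1.3(i): Liouville theorem for stable solutions, case `Γ κ^{p-2}(p-1) ≥ 1`. -/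
theorem liouville_stable_case_i {N : ℕ} (hN : 2 ≤ N)
    (H : EuclideanSpace ℝ (Fin N) → ℝ) (B : ℝ → ℝ)
    (u : EuclideanSpace ℝ (Fin N) → ℝ) (p κ γ Γ q : ℝ)
    (hH : IsFinslerNorm H) (hB : SatisfiesHB B p κ γ Γ) (hp : 2 ≤ p) (hq : 1 < q)
    (hu : ContDiff ℝ 1 u)
    (hsol : IsWeakSolutionOn Set.univ B H u q)
    (hstab : IsStableOn Set.univ Set.univ B H u q)
    (h1 : 1 ≤ Γ * κ ^ (p - 2) * (p - 1))
    (h2 : Γ ^ 2 * κ ^ (p - 2) * γ⁻¹ * (p - 1) ^ 2 < q)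
    (hNg : (N : ℝ) < 2 * (Γ ^ 2 * κ ^ (p - 2) * γ⁻¹ * (p - 1) ^ 2 * (q - 1) + 2 * q +
        2 * Real.sqrt (q * (q - Γ ^ 2 * κ ^ (p - 2) * γ⁻¹ * (p - 1) ^ 2))) /
        (Γ ^ 2 * κ ^ (p - 2) * γ⁻¹ * (p - 1) ^ 2 * (q - 1))) :
    ∀ x, u x = 0 := by
  have hB' := hB
  obtain ⟨-, -, -, -, -, -, -, hγ, hΓ, hB1, -⟩ := hB'
  set K := Γ ^ 2 * κ ^ (p - 2) * γ⁻¹ * (p - 1) ^ 2 with hK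
  have hp1 : 1 ≤ p - 1 := by linarith
  have hγΓ : γ ≤ Γ := by
    obtain ⟨h, h'⟩ := hB1 1 one_pos
    have hW : 0 < (κ + 1) ^ (p - 2) := Real.rpow_pos_of_pos (by linarith [hB.2.2.2.2.2.1]) _
    have := h.trans h'
    rw [mul_one, mul_one] at this
    exact le_of_mul_le_mul_right this hW
  have hKγ : Γ * (p - 1) ≤ K * γ := by
    have h : K * γ = (Γ * κ ^ (p - 2) * (p - 1)) * (Γ * (p - 1)) := by
      rw [hK]; field_simp
    rw [h]
    exact le_mul_of_one_le_left (by positivity) h1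
  have hKp : p - 1 ≤ K := by
    refine le_of_mul_le_mul_right ?_ hγ
    nlinarith
  obtain ⟨α, hα, hNα, hKα⟩ := exists_exponent (by linarith : 0 < K) h2 hq hNg
  have hlt : ((α + 1) / 2) ^ 2 * (Γ * (p - 1)) / (α * γ) < q := by
    rw [div_lt_iff₀ (by positivity)]
    have e1 := mul_le_mul_of_nonneg_left hKγ (sq_nonneg ((α + 1) / 2))
    have e2 := mul_lt_mul_of_pos_right hKα hγ
    linarith
  obtain ⟨k, hk1, hkq⟩ := exists_between hlt
  have hk0 : 0 ≤ k := le_trans (by positivity) hk1.le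
  rw [div_lt_iff₀ (by positivity), ← mul_assoc k] at hk1
  have hpq : p - 1 < q := by linarith
  obtain ⟨D, -, hD⟩ := exists_energy_estimate hH hB hp hu hsol hstab hq hpq hα hk0 hkq hk1
  refine eq_zero_of_energy_estimate hu.continuous (by linarith : 0 < q + α) hNα ?_ hD
  refine hNα.trans_le ?_
  rw [div_le_div_iff₀ (by linarith) (by linarith)]
  have : 0 ≤ (q + α) * ((p - 2) * (q + 1)) :=
    mul_nonneg (by linarith) (mul_nonneg (by linarith) (by linarith))
  linarith
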